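/- arXiv:2102.11786 — 2 statements merged into one kernel-verified Lean document; each statement's English description precedes it below -/
import Mathlib

section
/- Fix integers T ≥ 1, τ ≥ 1 with τ ≤ √T and τ dividing T, an integer n ≥ 1, reals λ ∈ ℝ and λ_p > 0. Define L_x := L + G·L_{Q1} + G_{Q1}·L·l_{Q1}, L_c := G·L_{Q2} + G_{Q2}·L·l_{Q2}, η₁ := 1/(2(2λ_p + L_x)), η₂ := 1/(2L_c), η₃ := 1/(4λ_p√T), and L_max := max{1, L_c, (5/3)λ_p + L_x}; assume additionally η₃ ≤ 2·min{2λ_p + L_x, L_c}. Suppose for each client i ∈ {1,…,n} there are sequences x_i⁰,…,x_i^T ∈ ℝ^d, c_i⁰,…,c_i^T ∈ ℝ^{m_i}, and w_i⁰,…,w_i^T ∈ ℝ^d with w_i⁰ = w⁰ common to all i, satisfying for every 0 ≤ t ≤ T−1: (i) x_i^{t+1} is a global minimizer over x ∈ ℝ^d of ⟨x − x_i^t, ∇f_i(x_i^t) + ∇_x f_i(Q̃^{(i)}_{c_i^t}(x))|_{x=x_i^t} + λ_p(x_i^t − w_i^t)⟩ + (1/(2η₁))‖x − x_i^t‖² +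 λ·R_i(x, c_i^t); (ii) c_i^{t+1} is a global minimizer over c ∈ ℝ^{m_i} of ⟨c − c_i^t, ∇_c f_i(Q̃^{(i)}_c(x_i^{t+1}))|_{c=c_i^t}⟩ + (1/(2η₂))‖c − c_i^t‖² + λ·R_i(x_i^{t+1}, c); (iii) with g_i^t := λ_p(w_i^t − x_i^{t+1}) (which equals ∇_w F_i(x_i^{t+1}, c_i^{t+1}, ·) at w_i^t): if τ does not divide t+1 then w_i^{t+1} = w_i^t − η₃·g_i^t, and if τ divides t+1 then w_i^{t+1} = (1/n)Σ_{j=1}^n (w_j^t − η₃·g_j^t). Set w^t := (1/n)Σ_{i=1}^n w_i^t. Assume the bounded-diversity condition: there are κ_i ≥ 0 with ‖∇_w F_i(x_i^{t+1}, c_i^{t+1}, w)|_{w=w^t} − (1/n)Σ_{j=1}^n ∇_w F_j(x_j^{t+1}, c_j^{t+1}, w)|_{w=w^t}‖² ≤ κ_i for all t, i, and set κ := (1/n)Σ_i κ_i. Define ‖G_i^t‖² := ‖∇_x F_i(x, c_i^t, w^t)|_{x=x_i^{t+1}}‖² + ‖∇_c F_i(x_i^{t+1}, c, w^t)|_{c=c_i^{t+1}}‖²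 + ‖∇_w F_i(x_i^{t+1}, c_i^{t+1}, w)|_{w=w^t}‖², and Δ_F := (1/n)Σ_{i=1}^n (F_i(x_i⁰, c_i⁰, w_i⁰) − F_i(x_i^T, c_i^T, w_i^T)). Then (1/T)·Σ_{t=0}^{T−1} (1/n)·Σ_{i=1}^n ‖G_i^t‖² ≤ (54·L_max²·τ·κ + 108·L_max² + 288·L_max²·λ_p·Δ_F)/√T + (189·L_max²·τ²·κ + (3/4)·τ²·κ²)/T + 378·L_max²·τ²·κ/T^{3/2} + 216·L_max²·κ. -/
open RealInnerProductSpace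

section helpers

variable {E F : Type*} [NormedAddCommGroup E] [InnerProductSpace ℝ E] [CompleteSpace E]
  [NormedAddCommGroup F] [InnerProductSpace ℝ F] [CompleteSpace F]

/-- The descent lemma. -/
theorem aux_descent (h : E → ℝ) (h' : E → E) (K : ℝ)
    (hh : ∀ y, HasGradientAt h (h' y) y) (hK : ∀ y z, ‖h' y - h' z‖ ≤ K * ‖y - z‖) (x y : E) :
    h y ≤ h x + ⟪y - x, h' x⟫ + K / 2 * ‖y - x‖ ^ 2 := by
  set φ : ℝ → ℝ := fun t => h (x + t • (y - x)) - t * ⟪y - x, h' x⟫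
    - K / 2 * ‖y - x‖ ^ 2 * t ^ 2 with hφ
  have hd : ∀ t, HasDerivAt φ (⟪h' (x + t • (y - x)), y - x⟫ - ⟪y - x, h' x⟫
      - K * ‖y - x‖ ^ 2 * t) t := by
    intro t
    have h1 : HasDerivAt (fun t : ℝ => x + t • (y - x)) (y - x) t := by
      simpa using ((hasDerivAt_id t).smul_const (y - x)).const_add x
    have h2 := (hh (x + t • (y - x))).hasFDerivAt.comp_hasDerivAt t h1
    have h3 : HasDerivAt (fun t : ℝ => t * ⟪y - x, h' x⟫) ⟪y - x, h' x⟫ t := by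
      simpa using (hasDerivAt_id t).mul_const ⟪y - x, h' x⟫
    have h4 : HasDerivAt (fun t : ℝ => K / 2 * ‖y - x‖ ^ 2 * t ^ 2) (K * ‖y - x‖ ^ 2 * t) t := by
      have := (hasDerivAt_pow 2 t).const_mul (K / 2 * ‖y - x‖ ^ 2)
      refine this.congr_deriv ?_
      push_cast; ring
    have h5 := (h2.sub h3).sub h4
    refine h5.congr_deriv ?_
    simp
  have hanti : AntitoneOn φ (Set.Icc 0 1) := by
    apply antitoneOn_of_deriv_nonpos (convex_Icc 0 1)
    · exact fun t _ => (hd t).continuousAt.continuousWithinAt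
    · exact fun t _ => (hd t).differentiableAt.differentiableWithinAt
    · intro t ht
      rw [interior_Icc] at ht
      rw [(hd t).deriv, real_inner_comm (h' x) (y - x), ← inner_sub_left]
      have h1 := real_inner_le_norm (h' (x + t • (y - x)) - h' x) (y - x)
      have h2 := hK (x + t • (y - x)) x
      rw [add_sub_cancel_left, norm_smul, Real.norm_of_nonneg ht.1.le] at h2
      have h3 := mul_le_mul_of_nonneg_right h2 (norm_nonneg (y - x))
      nlinarith
  have := hanti (Set.left_mem_Icc.2 zero_le_one) (Set.right_mem_Icc.2 zero_le_one) zero_le_one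
  simp [hφ] at this
  linarith

/-- Gradients of compositions are Lipschitz. -/
theorem aux_comp (f : E → ℝ) (Q : F → E) (G L l LQ GQ : ℝ)
    (hL : 0 ≤ L) (hf : Differentiable ℝ f) (hQ : Differentiable ℝ Q)
    (hfG : ∀ x, ‖gradient f x‖ ≤ G)
    (hfL : ∀ x y, ‖gradient f x - gradient f y‖ ≤ L * ‖x - y‖)
    (hl : ∀ x y, ‖Q x - Q y‖ ≤ l * ‖x - y‖)
    (hLQ : ∀ x y, ‖fderiv ℝ Q x - fderiv ℝ Q y‖ ≤ LQ * ‖x - y‖)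
    (hGQ : ∀ x, ‖fderiv ℝ Q x‖ ≤ GQ) (x y : F) :
    ‖gradient (fun z => f (Q z)) x - gradient (fun z => f (Q z)) y‖
      ≤ (G * LQ + GQ * L * l) * ‖x - y‖ := by
  have e1 : ∀ x, fderiv ℝ (fun z => f (Q z)) x = (fderiv ℝ f (Q x)).comp (fderiv ℝ Q x) :=
    fun x => fderiv_comp x (hf (Q x)) (hQ x)
  have e2 : ‖gradient (fun z => f (Q z)) x - gradient (fun z => f (Q z)) y‖
      = ‖fderiv ℝ (fun z => f (Q z)) x - fderiv ℝ (fun z => f (Q z)) y‖ := by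
    unfold gradient
    rw [← map_sub, LinearIsometryEquiv.norm_map]
  have e3 : ∀ a, ‖fderiv ℝ f a‖ ≤ G := by
    intro a
    have := hfG a
    unfold gradient at this
    rwa [LinearIsometryEquiv.norm_map] at this
  have e4 : ∀ a b, ‖fderiv ℝ f a - fderiv ℝ f b‖ ≤ L * ‖a - b‖ := by
    intro a b
    have := hfL a b
    unfold gradient at this
    rwa [← map_sub, LinearIsometryEquiv.norm_map] at this
  rw [e2, e1, e1]
  have e5 : (fderiv ℝ f (Q x)).comp (fderiv ℝ Q x) - (fderiv ℝ f (Q y)).comp (fderiv ℝ Q y)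
      = (fderiv ℝ f (Q x)).comp (fderiv ℝ Q x - fderiv ℝ Q y)
        + (fderiv ℝ f (Q x) - fderiv ℝ f (Q y)).comp (fderiv ℝ Q y) := by
    ext v; simp
  rw [e5]
  have hG0 : 0 ≤ G := (norm_nonneg _).trans (e3 (Q x))
  calc _ ≤ ‖(fderiv ℝ f (Q x))‖ * ‖fderiv ℝ Q x - fderiv ℝ Q y‖
        + ‖fderiv ℝ f (Q x) - fderiv ℝ f (Q y)‖ * ‖fderiv ℝ Q y‖ :=
        (norm_add_le _ _).trans (add_le_add (ContinuousLinearMap.opNorm_comp_le _ _)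
          (ContinuousLinearMap.opNorm_comp_le _ _))
    _ ≤ G * (LQ * ‖x - y‖) + (L * (l * ‖x - y‖)) * GQ := by
        have h1 := (e4 (Q x) (Q y)).trans (mul_le_mul_of_nonneg_left (hl x y) hL)
        exact add_le_add (mul_le_mul (e3 _) (hLQ x y) (norm_nonneg _) hG0)
          (mul_le_mul h1 (hGQ y) (norm_nonneg _) ((norm_nonneg _).trans h1))
    _ = _ := by ring

theorem aux_sq_grad (p : ℝ) (w y : E) :
    HasGradientAt (fun z => p / 2 * ‖z - w‖ ^ 2) (p • (y - w)) y := by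
  rw [hasGradientAt_iff_hasFDerivAt]
  have h1 : HasFDerivAt (fun z : E => z - w) (ContinuousLinearMap.id ℝ E) y :=
    (hasFDerivAt_id y).sub_const w
  have := (h1.norm_sq).const_mul (p / 2)
  refine this.congr_fderiv ?_
  ext v
  simp
  ring

theorem aux_inner_grad (x v y : E) : HasGradientAt (fun z => ⟪z - x, v⟫) v y := by
  rw [hasGradientAt_iff_hasFDerivAt]
  have h1 : HasFDerivAt (fun z : E => z - x) (ContinuousLinearMap.id ℝ E) y :=
    (hasFDerivAt_id y).sub_const x
  have := h1.inner ℝ (hasFDerivAt_const v y)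
  refine this.congr_fderiv ?_
  ext u
  simp [real_inner_comm]

theorem aux_add_grad {f g : E → ℝ} {a b x : E} (hf : HasGradientAt f a x)
    (hg : HasGradientAt g b x) : HasGradientAt (fun z => f z + g z) (a + b) x := by
  rw [hasGradientAt_iff_hasFDerivAt] at *
  rw [map_add]
  exact hf.add hg

/-- One proximal step. -/
theorem aux_prox (h r : E → ℝ) (h' : E → E) (K p M : ℝ) (hp : 0 ≤ p) (hM : 0 ≤ M)
    (hh : ∀ y, HasGradientAt h (h' y) y) (hr : Differentiable ℝ r)
    (hK : ∀ y z, ‖h' y - h' z‖ ≤ K * ‖y - z‖) (x y w : E)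
    (hmin : ∀ z, ⟪y - x, h' x + p • (x - w)⟫ + M * ‖y - x‖ ^ 2 + r y
      ≤ ⟪z - x, h' x + p • (x - w)⟫ + M * ‖z - x‖ ^ 2 + r z) :
    (h y + r y + p / 2 * ‖y - w‖ ^ 2
      ≤ h x + r x + p / 2 * ‖x - w‖ ^ 2 - (M - (K + p) / 2) * ‖y - x‖ ^ 2) ∧
    ∀ (w' : E) (φ : E → ℝ) (k : ℝ), (∀ z, φ z = k + h z + r z + p / 2 * ‖z - w'‖ ^ 2) →
      ‖gradient φ y‖ ≤ (K + p + 2 * M) * ‖y - x‖ + p * ‖w - w'‖ := by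
  constructor
  · have h1 := hmin x
    have h2 := aux_descent h h' K hh hK x y
    have h3 : ‖y - w‖ ^ 2 = ‖y - x‖ ^ 2 + 2 * ⟪y - x, x - w⟫ + ‖x - w‖ ^ 2 := by
      rw [← norm_add_sq_real]; congr 2; abel
    simp [inner_add_right, inner_smul_right] at h1
    rw [h3]
    nlinarith
  · intro w' φ k hφ
    have g1 : HasGradientAt (fun z => ⟪z - x, h' x + p • (x - w)⟫
        + (2 * M) / 2 * ‖z - x‖ ^ 2 + r z)
        (h' x + p • (x - w) + (2 * M) • (y - x) + gradient r y) y :=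
      aux_add_grad (aux_add_grad (aux_inner_grad _ _ _) (aux_sq_grad _ _ _))
        (hr y).hasGradientAt
    have hm : IsLocalMin (fun z => ⟪z - x, h' x + p • (x - w)⟫
        + (2 * M) / 2 * ‖z - x‖ ^ 2 + r z) y := by
      refine Filter.Eventually.of_forall fun z => ?_
      have := hmin z
      simp only [mul_div_cancel_left₀ M (two_ne_zero' ℝ)]
      exact this
    have g2 := hm.hasFDerivAt_eq_zero g1.hasFDerivAt
    have g3 : h' x + p • (x - w) + (2 * M) • (y - x) + gradient r y = 0 := by
      exact (InnerProductSpace.toDual ℝ E).map_eq_zero_iff.1 g2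
    have g4 : HasGradientAt φ (0 + h' y + gradient r y + p • (y - w')) y := by
      rw [funext hφ]
      exact aux_add_grad (aux_add_grad (aux_add_grad (hasGradientAt_const _ _) (hh y))
        (hr y).hasGradientAt) (aux_sq_grad _ _ _)
    rw [g4.gradient]
    have g5 : 0 + h' y + gradient r y + p • (y - w')
        = (h' y - h' x) + (p - 2 * M) • (y - x) + p • (w - w') := by
      have : gradient r y = - (h' x + p • (x - w) + (2 * M) • (y - x)) := by
        rw [eq_neg_iff_add_eq_zero, add_comm]; exact g3
      rw [this]; module
    rw [g5]
    refine (norm_add_le _ _).trans ?_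
    have n1 := norm_add_le (h' y - h' x) ((p - 2 * M) • (y - x))
    have n2 : ‖(p - 2 * M) • (y - x)‖ ≤ (p + 2 * M) * ‖y - x‖ := by
      rw [norm_smul]
      refine mul_le_mul_of_nonneg_right ?_ (norm_nonneg _)
      rw [Real.norm_eq_abs, abs_le]; constructor <;> linarith
    have n3 : ‖p • (w - w')‖ = p * ‖w - w'‖ := by
      rw [norm_smul, Real.norm_of_nonneg hp]
    have n4 := hK y x
    rw [n3]; linarith

end helpers

section consensus

variable {E : Type*} [NormedAddCommGroup E] [InnerProductSpace ℝ E]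

theorem aux_var {n : ℕ} (ν : ℝ) (hν : ν * n = 1) (v : Fin n → E) (vb : E)
    (hvb : vb = ν • ∑ i, v i) (s : ℝ) :
    ν * ∑ i, ‖v i - s • vb‖ ^ 2 = ν * ∑ i, ‖v i‖ ^ 2 + (s ^ 2 - 2 * s) * ‖vb‖ ^ 2 := by
  have h1 : ∀ i, ‖v i - s • vb‖ ^ 2 = ‖v i‖ ^ 2 - 2 * s * ⟪v i, vb⟫ + s ^ 2 * ‖vb‖ ^ 2 := by
    intro i
    rw [norm_sub_sq_real, inner_smul_right, norm_smul, mul_pow, Real.norm_eq_abs, sq_abs]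
    ring
  have h2 : ν * ∑ i, ⟪v i, vb⟫ = ‖vb‖ ^ 2 := by
    rw [← sum_inner, ← real_inner_smul_left, ← hvb, real_inner_self_eq_norm_sq]
  simp only [h1, Finset.sum_add_distrib, Finset.sum_sub_distrib, ← Finset.mul_sum,
    Finset.sum_const, Finset.card_univ, Fintype.card_fin, nsmul_eq_mul]
  linear_combination (-2 * s) * h2 + s ^ 2 * ‖vb‖ ^ 2 * hν

theorem aux_jensen {n : ℕ} (ν : ℝ) (hν : ν * n = 1) (hν0 : 0 ≤ ν) (v : Fin n → E) (vb : E)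
    (hvb : vb = ν • ∑ i, v i) : ‖vb‖ ^ 2 ≤ ν * ∑ i, ‖v i‖ ^ 2 := by
  have h := aux_var ν hν v vb hvb 1
  have : 0 ≤ ν * ∑ i, ‖v i - (1 : ℝ) • vb‖ ^ 2 :=
    mul_nonneg hν0 (Finset.sum_nonneg fun _ _ => sq_nonneg _)
  linarith

theorem aux_mod (t τ : ℕ) (hτ : 1 ≤ τ) :
    (τ ∣ t + 1 → (t + 1) % τ = 0) ∧ (¬ τ ∣ t + 1 → (t + 1) % τ = t % τ + 1) := by
  constructor
  · exact fun h => Nat.mod_eq_zero_of_dvd h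
  · intro h
    have h1 := Nat.mod_lt t (show 0 < τ by omega)
    have h2 := Nat.mod_add_div t τ
    have h3 : t % τ + 1 ≠ τ := by
      intro h4
      apply h
      refine ⟨t / τ + 1, ?_⟩
      rw [mul_add]; omega
    have h5 : t + 1 = (t % τ + 1) + τ * (t / τ) := by omega
    rw [h5, Nat.add_mul_mod_self_left, Nat.mod_eq_of_lt (by omega)]

theorem aux_cons {n T τ : ℕ} (hτ : 1 ≤ τ) (ν : ℝ) (hν : ν * n = 1) (hν0 : 0 ≤ ν)
    (p q : ℝ) (hp : 0 < p) (hq : 0 ≤ q) (hq1 : q ≤ 1)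
    (w X : Fin n → ℕ → E) (w0 : E) (hw0 : ∀ i, w i 0 = w0)
    (hw : ∀ i, ∀ t < T,
      (¬ τ ∣ (t + 1) → w i (t + 1) = w i t - q • (w i t - X i t)) ∧
      (τ ∣ (t + 1) → w i (t + 1) = ν • ∑ j, (w j t - q • (w j t - X j t))))
    (wb vb : ℕ → E) (hwb : ∀ t, wb t = ν • ∑ i, w i t)
    (hvb : ∀ t, vb t = ν • ∑ i, (wb t - X i t))
    (κ : Fin n → ℝ) (hκ0 : ∀ i, 0 ≤ κ i) (κb : ℝ) (hκb : κb = ν * ∑ i, κ i)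
    (hκ : ∀ t < T, ∀ i, p * ‖(wb t - X i t) - vb t‖ ≤ √(κ i)) :
    (∀ t ≤ T, ∀ i, p * ‖w i t - wb t‖ ≤ q * √(κ i) * (t % τ : ℕ)) ∧
    (∀ t < T, p / 2 * (ν * ∑ i, ‖w i (t + 1) - X i t‖ ^ 2)
      ≤ p / 2 * (ν * ∑ i, ‖w i t - X i t‖ ^ 2) - p * (q - q ^ 2 / 2) * ‖vb t‖ ^ 2
        + q * κb / p * (1 + (t % τ : ℕ) - ((t + 1) % τ : ℕ))) ∧
    (∀ t < T, p ^ 2 * (ν * ∑ i, ‖wb t - X i t‖ ^ 2) ≤ p ^ 2 * ‖vb t‖ ^ 2 + κb) := by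
  have hconst : ∀ a : E, ν • ∑ _i : Fin n, a = a := by
    intro a
    simp only [Finset.sum_const, Finset.card_univ, Fintype.card_fin]
    rw [← Nat.cast_smul_eq_nsmul ℝ, smul_smul, hν, one_smul]
  have hvb2 : ∀ t, vb t = ν • ∑ i, (w i t - X i t) := by
    intro t
    rw [hvb, Finset.sum_sub_distrib, smul_sub, hconst, Finset.sum_sub_distrib, smul_sub, hwb]
  have havg : ∀ t, ν • ∑ j, (w j t - q • (w j t - X j t)) = wb t - q • vb t := by
    intro t
    rw [Finset.sum_sub_distrib, smul_sub, ← hwb, ← Finset.smul_sum, smul_comm, ← hvb2]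
  have hwb1 : ∀ t < T, wb (t + 1) = wb t - q • vb t := by
    intro t ht
    by_cases hd : τ ∣ t + 1
    · rw [hwb (t + 1), Finset.sum_congr rfl fun i _ => (hw i t ht).2 hd, hconst, havg]
    · rw [hwb (t + 1), Finset.sum_congr rfl fun i _ => (hw i t ht).1 hd, havg]
  have hdrift : ∀ t ≤ T, ∀ i, p * ‖w i t - wb t‖ ≤ q * √(κ i) * (t % τ : ℕ) := by
    intro t
    induction t with
    | zero =>
      intro _ i
      rw [hwb]; simp only [hw0, hconst]; simp
    | succ t ih =>
      intro ht i
      have ht' : t < T := ht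
      by_cases hd : τ ∣ t + 1
      · rw [(hw i t ht').2 hd, havg, hwb1 t ht', (aux_mod t τ hτ).1 hd]; simp
      · rw [(hw i t ht').1 hd, hwb1 t ht', (aux_mod t τ hτ).2 hd]
        have e : w i t - q • (w i t - X i t) - (wb t - q • vb t)
            = (1 - q) • (w i t - wb t) - q • ((wb t - X i t) - vb t) := by module
        rw [e]
        have n1 := norm_sub_le ((1 - q) • (w i t - wb t)) (q • ((wb t - X i t) - vb t))
        rw [norm_smul, norm_smul, Real.norm_of_nonneg hq,
          Real.norm_of_nonneg (sub_nonneg.2 hq1)] at n1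
        have n2 := ih ht'.le i
        have n3 := mul_le_mul_of_nonneg_left (hκ t ht' i) hq
        have n4 : 0 ≤ q * (p * ‖w i t - wb t‖) := by positivity
        have n5 := mul_le_mul_of_nonneg_left n1 hp.le
        push_cast
        nlinarith
  have hκb0 : 0 ≤ κb := by
    rw [hκb]; exact mul_nonneg hν0 (Finset.sum_nonneg fun i _ => hκ0 i)
  refine ⟨hdrift, ?_, ?_⟩
  · intro t ht
    by_cases hd : τ ∣ t + 1
    · rw [(aux_mod t τ hτ).1 hd]
      have e1 : ∀ i, w i (t + 1) - X i t = (wb t - X i t) - q • vb t := by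
        intro i; rw [(hw i t ht).2 hd, havg]; abel
      simp only [e1]
      rw [aux_var ν hν (fun i => wb t - X i t) (vb t) (hvb t) q]
      -- cross term
      have hsum0 : ∑ i, (w i t - wb t) = 0 := by
        have : ν • ∑ i, (w i t - wb t) = 0 := by
          rw [Finset.sum_sub_distrib, smul_sub, hconst, ← hwb, sub_self]
        rcases smul_eq_zero.1 this with h | h
        · rw [h] at hν; simp at hν
        · exact h
      have hcross0 : ∑ i, ⟪vb t, w i t - wb t⟫ = 0 := by
        rw [← inner_sum, hsum0, inner_zero_right]
      have e2 : ∀ i, ‖wb t - X i t‖ ^ 2 ≤ ‖w i t - X i t‖ ^ 2 - 2 * ⟪vb t, w i t - wb t⟫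
          + 2 * (q * (t % τ : ℕ) / p ^ 2) * κ i := by
        intro i
        have e3 : ‖w i t - X i t‖ ^ 2 = ‖wb t - X i t‖ ^ 2
            + 2 * ⟪wb t - X i t, w i t - wb t⟫ + ‖w i t - wb t‖ ^ 2 := by
          rw [← norm_add_sq_real]; congr 2; abel
        have e4 : ⟪wb t - X i t, w i t - wb t⟫ = ⟪(wb t - X i t) - vb t, w i t - wb t⟫
            + ⟪vb t, w i t - wb t⟫ := by rw [← inner_add_left]; simp
        have e5 := neg_le_of_abs_le (abs_real_inner_le_norm ((wb t - X i t) - vb t) (w i t - wb t))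
        have e6 := mul_le_mul (hκ t ht i) (hdrift t ht.le i) (by positivity) (Real.sqrt_nonneg _)
        have e7 : √(κ i) * (q * √(κ i) * (t % τ : ℕ)) = q * (t % τ : ℕ) * κ i := by
          linear_combination q * (t % τ : ℕ) * Real.mul_self_sqrt (hκ0 i)
        rw [e7] at e6
        have e8 : ‖(wb t - X i t) - vb t‖ * ‖w i t - wb t‖ ≤ (q * (t % τ : ℕ) / p ^ 2) * κ i := by
          rw [div_mul_eq_mul_div, le_div_iff₀ (by positivity)]
          linarith
        rw [e3, e4]
        nlinarith [sq_nonneg ‖w i t - wb t‖]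
      have e9 := Finset.sum_le_sum fun i (_ : i ∈ Finset.univ) => e2 i
      rw [Finset.sum_add_distrib, Finset.sum_sub_distrib, ← Finset.mul_sum, hcross0,
        ← Finset.mul_sum] at e9
      have e10 := mul_le_mul_of_nonneg_left e9 (show 0 ≤ p / 2 * ν by positivity)
      have e11 : p / 2 * ν * (2 * (q * (t % τ : ℕ) / p ^ 2) * ∑ i, κ i)
          = q * κb / p * (t % τ : ℕ) := by
        rw [hκb]; field_simp
      have e12 : 0 ≤ q * κb / p := by positivity
      push_cast
      linarith
    · rw [(aux_mod t τ hτ).2 hd]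
      have e1 : ∀ i, ‖w i (t + 1) - X i t‖ ^ 2 = (1 - q) ^ 2 * ‖w i t - X i t‖ ^ 2 := by
        intro i
        have : w i (t + 1) - X i t = (1 - q) • (w i t - X i t) := by
          rw [(hw i t ht).1 hd]; module
        rw [this, norm_smul, mul_pow, Real.norm_eq_abs, sq_abs]
      simp only [e1, ← Finset.mul_sum]
      have e2 := aux_jensen ν hν hν0 _ _ (hvb2 t)
      have e3 : 0 ≤ p * (q - q ^ 2 / 2) := by
        apply mul_nonneg hp.le; nlinarith
      have e4 := mul_le_mul_of_nonneg_left e2 e3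
      push_cast
      linarith
  · intro t ht
    have e1 := aux_var ν hν (fun i => wb t - X i t) (vb t) (hvb t) 1
    simp only [one_smul] at e1
    have e2 : ∀ i, p ^ 2 * ‖wb t - X i t - vb t‖ ^ 2 ≤ κ i := by
      intro i
      rw [← mul_pow, ← Real.sq_sqrt (hκ0 i)]
      exact pow_le_pow_left₀ (by positivity) (hκ t ht i) 2
    have e3 := Finset.sum_le_sum fun i (_ : i ∈ Finset.univ) => e2 i
    rw [← Finset.mul_sum] at e3
    have e4 := mul_le_mul_of_nonneg_left e3 hν0
    rw [← hκb] at e4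
    have e5 : p ^ 2 * (ν * ∑ i, ‖wb t - X i t - vb t‖ ^ 2) ≤ κb := by linarith
    rw [e1] at e5
    linarith

end consensus

set_option maxHeartbeats 4000000 in
/-- Convergence of QuPeL, the quantized personalized federated learning scheme
(Theorem 2 of the paper). -/
theorem stmt_1
    {d n T τ : ℕ} (hd : 1 ≤ d) (hn : 1 ≤ n) (hT : 1 ≤ T) (hτ : 1 ≤ τ)
    (hτT : τ ∣ T) (hτsqrt : (τ : ℝ) ≤ Real.sqrt T)
    (mm : Fin n → ℕ) (hmm : ∀ i, 1 ≤ mm i)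
    (lam lam_p : ℝ) (hlam_p : 0 < lam_p)
    (G L lQ1 LQ1 GQ1 lQ2 LQ2 GQ2 : ℝ)
    (f : Fin n → EuclideanSpace ℝ (Fin d) → ℝ)
    (Qt : ∀ i : Fin n, EuclideanSpace ℝ (Fin d) → EuclideanSpace ℝ (Fin (mm i)) →
      EuclideanSpace ℝ (Fin d))
    (R : ∀ i : Fin n, EuclideanSpace ℝ (Fin d) → EuclideanSpace ℝ (Fin (mm i)) → ℝ)
    (hf : ∀ i, Differentiable ℝ (f i))
    (hfG : ∀ i x, ‖gradient (f i) x‖ ≤ G)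
    (hfL : ∀ i x y, ‖gradient (f i) x - gradient (f i) y‖ ≤ L * ‖x - y‖)
    (hQd1 : ∀ i c, Differentiable ℝ (fun x => Qt i x c))
    (hQd2 : ∀ i x, Differentiable ℝ (fun c => Qt i x c))
    (hQl1 : ∀ i c x y, ‖Qt i x c - Qt i y c‖ ≤ lQ1 * ‖x - y‖)
    (hQL1 : ∀ i c x y,
      ‖fderiv ℝ (fun z => Qt i z c) x - fderiv ℝ (fun z => Qt i z c) y‖ ≤ LQ1 * ‖x - y‖)
    (hQG1 : ∀ i c x, ‖fderiv ℝ (fun z => Qt i z c) x‖ ≤ GQ1)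
    (hQl2 : ∀ i x c c', ‖Qt i x c - Qt i x c'‖ ≤ lQ2 * ‖c - c'‖)
    (hQL2 : ∀ i x c c',
      ‖fderiv ℝ (fun e => Qt i x e) c - fderiv ℝ (fun e => Qt i x e) c'‖ ≤ LQ2 * ‖c - c'‖)
    (hQG2 : ∀ i x c, ‖fderiv ℝ (fun e => Qt i x e) c‖ ≤ GQ2)
    (hRd1 : ∀ i c, Differentiable ℝ (fun x => R i x c))
    (hRd2 : ∀ i x, Differentiable ℝ (fun c => R i x c))
    (Fi : ∀ i : Fin n, EuclideanSpace ℝ (Fin d) → EuclideanSpace ℝ (Fin (mm i)) →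
      EuclideanSpace ℝ (Fin d) → ℝ)
    (hFi : ∀ (i : Fin n) (xx : EuclideanSpace ℝ (Fin d)) (cc : EuclideanSpace ℝ (Fin (mm i)))
      (ww : EuclideanSpace ℝ (Fin d)),
      Fi i xx cc ww = f i xx + f i (Qt i xx cc) + lam * R i xx cc + (lam_p / 2) * ‖xx - ww‖ ^ 2)
    (Lx Lc η₁ η₂ η₃ Lmax : ℝ)
    (hLx : Lx = L + G * LQ1 + GQ1 * L * lQ1)
    (hLc : Lc = G * LQ2 + GQ2 * L * lQ2)
    (hη₁ : η₁ = 1 / (2 * (2 * lam_p + Lx)))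
    (hη₂ : η₂ = 1 / (2 * Lc))
    (hη₃ : η₃ = 1 / (4 * lam_p * Real.sqrt T))
    (hLmax : Lmax = max 1 (max Lc (5 / 3 * lam_p + Lx)))
    (hη₃' : η₃ ≤ 2 * min (2 * lam_p + Lx) Lc)
    (x : Fin n → ℕ → EuclideanSpace ℝ (Fin d))
    (c : ∀ i : Fin n, ℕ → EuclideanSpace ℝ (Fin (mm i)))
    (w : Fin n → ℕ → EuclideanSpace ℝ (Fin d))
    (w0 : EuclideanSpace ℝ (Fin d)) (hw0 : ∀ i, w i 0 = w0)
    (g : Fin n → ℕ → EuclideanSpace ℝ (Fin d))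
    (hg : ∀ i t, g i t = lam_p • (w i t - x i (t + 1)))
    (hx : ∀ i, ∀ t < T, ∀ z : EuclideanSpace ℝ (Fin d),
      ⟪x i (t + 1) - x i t, gradient (f i) (x i t)
          + gradient (fun y => f i (Qt i y (c i t))) (x i t)
          + lam_p • (x i t - w i t)⟫
        + (1 / (2 * η₁)) * ‖x i (t + 1) - x i t‖ ^ 2 + lam * R i (x i (t + 1)) (c i t)
      ≤ ⟪z - x i t, gradient (f i) (x i t)
          + gradient (fun y => f i (Qt i y (c i t))) (x i t)
          + lam_p • (x i t - w i t)⟫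
        + (1 / (2 * η₁)) * ‖z - x i t‖ ^ 2 + lam * R i z (c i t))
    (hcup : ∀ i, ∀ t < T, ∀ e : EuclideanSpace ℝ (Fin (mm i)),
      ⟪c i (t + 1) - c i t, gradient (fun e' => f i (Qt i (x i (t + 1)) e')) (c i t)⟫
        + (1 / (2 * η₂)) * ‖c i (t + 1) - c i t‖ ^ 2 + lam * R i (x i (t + 1)) (c i (t + 1))
      ≤ ⟪e - c i t, gradient (fun e' => f i (Qt i (x i (t + 1)) e')) (c i t)⟫
        + (1 / (2 * η₂)) * ‖e - c i t‖ ^ 2 + lam * R i (x i (t + 1)) e)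
    (hw : ∀ i, ∀ t < T,
      (¬ τ ∣ (t + 1) → w i (t + 1) = w i t - η₃ • g i t) ∧
      (τ ∣ (t + 1) → w i (t + 1) = (1 / (n : ℝ)) • ∑ j, (w j t - η₃ • g j t)))
    (wbar : ℕ → EuclideanSpace ℝ (Fin d))
    (hwbar : ∀ t, wbar t = (1 / (n : ℝ)) • ∑ i, w i t)
    (κ : Fin n → ℝ) (hκ : ∀ i, 0 ≤ κ i)
    (hdiv : ∀ t < T, ∀ i,
      ‖gradient (fun u => Fi i (x i (t + 1)) (c i (t + 1)) u) (wbar t)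
          - (1 / (n : ℝ)) • ∑ j, gradient (fun u => Fi j (x j (t + 1)) (c j (t + 1)) u) (wbar t)‖ ^ 2
        ≤ κ i)
    (κbar ΔF : ℝ)
    (hκbar : κbar = (1 / (n : ℝ)) * ∑ i, κ i)
    (hΔF : ΔF = (1 / (n : ℝ)) *
      ∑ i, (Fi i (x i 0) (c i 0) (w i 0) - Fi i (x i T) (c i T) (w i T))) :
    (1 / (T : ℝ)) * ∑ t ∈ Finset.range T, (1 / (n : ℝ)) * ∑ i,
        (‖gradient (fun y => Fi i y (c i t) (wbar t)) (x i (t + 1))‖ ^ 2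
          + ‖gradient (fun e => Fi i (x i (t + 1)) e (wbar t)) (c i (t + 1))‖ ^ 2
          + ‖gradient (fun u => Fi i (x i (t + 1)) (c i (t + 1)) u) (wbar t)‖ ^ 2)
      ≤ (54 * Lmax ^ 2 * τ * κbar + 108 * Lmax ^ 2 + 288 * Lmax ^ 2 * lam_p * ΔF) / Real.sqrt T
        + (189 * Lmax ^ 2 * τ ^ 2 * κbar + (3 / 4) * τ ^ 2 * κbar ^ 2) / (T : ℝ)
        + 378 * Lmax ^ 2 * τ ^ 2 * κbar / (T : ℝ) ^ ((3 : ℝ) / 2)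
        + 216 * Lmax ^ 2 * κbar := by
  -- basic positivity
  have hn0 : (0 : ℝ) < n := by exact_mod_cast hn
  have hT0 : (0 : ℝ) < T := by exact_mod_cast hT
  have hT1 : (1 : ℝ) ≤ T := by exact_mod_cast hT
  obtain ⟨ν, hνdef⟩ : ∃ ν : ℝ, ν = 1 / (n : ℝ) := ⟨_, rfl⟩
  rw [← hνdef] at hκbar hΔF ⊢
  simp only [← hνdef] at hw hwbar hdiv
  have hν : ν * n = 1 := by rw [hνdef]; field_simp
  have hν0 : 0 ≤ ν := by rw [hνdef]; positivity
  obtain ⟨S, hS⟩ : ∃ S : ℝ, S = √(T : ℝ) := ⟨_, rfl⟩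
  rw [← hS] at hη₃ ⊢
  have hS1 : 1 ≤ S := by rw [hS]; exact Real.one_le_sqrt.2 hT1
  have hS2 : S ^ 2 = T := by rw [hS]; exact Real.sq_sqrt hT0.le
  have hS0 : 0 < S := by linarith
  let i0 : Fin n := ⟨0, hn⟩
  have hη₃0 : 0 < η₃ := by rw [hη₃]; positivity
  have hmin1 := min_le_left (2 * lam_p + Lx) Lc
  have hmin2 := min_le_right (2 * lam_p + Lx) Lc
  have hM1 : 0 < 2 * lam_p + Lx := by linarith
  have hLc0 : 0 < Lc := by linarith
  have hL0 : 0 ≤ L := by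
    have h1 := hfL i0 (EuclideanSpace.single ⟨0, hd⟩ 1) 0
    have h2 := (norm_nonneg _).trans h1
    simpa using h2
  have hG0 : 0 ≤ G := (norm_nonneg _).trans (hfG i0 0)
  have hGQ0 : 0 ≤ GQ1 := (norm_nonneg _).trans (hQG1 i0 0 0)
  have hlQ0 : 0 ≤ lQ1 := by
    have h2 := (norm_nonneg _).trans (hQl1 i0 0 (EuclideanSpace.single ⟨0, hd⟩ 1) 0)
    simpa using h2
  have hLQ0 : 0 ≤ LQ1 := by
    have h2 := (norm_nonneg _).trans (hQL1 i0 0 (EuclideanSpace.single ⟨0, hd⟩ 1) 0)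
    simpa using h2
  have hLx0 : 0 ≤ Lx := by rw [hLx]; positivity
  have hk1 : 1 ≤ 8 * lam_p * S * (2 * lam_p + Lx) := by
    have h1 : η₃ ≤ 2 * (2 * lam_p + Lx) := by linarith
    rw [hη₃, div_le_iff₀ (by positivity)] at h1
    linarith
  have hk2 : 1 ≤ 8 * lam_p * S * Lc := by
    have h1 : η₃ ≤ 2 * Lc := by linarith
    rw [hη₃, div_le_iff₀ (by positivity)] at h1
    linarith
  have hLm1 : 1 ≤ Lmax := by rw [hLmax]; exact le_max_left _ _
  have hLmc : Lc ≤ Lmax := by rw [hLmax]; exact (le_max_left _ _).trans (le_max_right _ _)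
  have hLmx : 5 / 3 * lam_p + Lx ≤ Lmax := by
    rw [hLmax]; exact (le_max_right _ _).trans (le_max_right _ _)
  have hη₁' : 1 / (2 * η₁) = 2 * lam_p + Lx := by rw [hη₁]; field_simp
  have hη₂' : 1 / (2 * η₂) = Lc := by rw [hη₂]; field_simp
  rw [hη₁'] at hx
  rw [hη₂'] at hcup
  obtain ⟨q, hq⟩ : ∃ q : ℝ, q = η₃ * lam_p := ⟨_, rfl⟩
  have hqS : q * S = 1 / 4 := by rw [hq, hη₃]; field_simp
  have hq0 : 0 < q := by rw [hq]; positivity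
  have hq4 : q ≤ 1 / 4 := by nlinarith
  -- gradients in w
  have hgw : ∀ i t u, gradient (fun u => Fi i (x i (t + 1)) (c i (t + 1)) u) u
      = lam_p • (u - x i (t + 1)) := by
    intro i t u
    have e : (fun u => Fi i (x i (t + 1)) (c i (t + 1)) u) = fun u =>
        (f i (x i (t + 1)) + f i (Qt i (x i (t + 1)) (c i (t + 1)))
          + lam * R i (x i (t + 1)) (c i (t + 1))) + lam_p / 2 * ‖u - x i (t + 1)‖ ^ 2 := by
      funext u; rw [hFi, norm_sub_rev]
    rw [e]
    have := aux_add_grad (hasGradientAt_const u (f i (x i (t + 1))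
      + f i (Qt i (x i (t + 1)) (c i (t + 1))) + lam * R i (x i (t + 1)) (c i (t + 1))))
      (aux_sq_grad lam_p (x i (t + 1)) u)
    rw [this.gradient, zero_add]
  simp only [hgw] at hdiv ⊢
  obtain ⟨vb, hvb⟩ : ∃ vb : ℕ → EuclideanSpace ℝ (Fin d),
    ∀ t, vb t = ν • ∑ i, (wbar t - x i (t + 1)) := ⟨_, fun _ => rfl⟩
  have hgq : ∀ i t, η₃ • g i t = q • (w i t - x i (t + 1)) := by
    intro i t; rw [hg, smul_smul, hq]
  simp only [hgq] at hw
  have hκ' : ∀ t < T, ∀ i, lam_p * ‖(wbar t - x i (t + 1)) - vb t‖ ≤ √(κ i) := by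
    intro t ht i
    apply Real.le_sqrt_of_sq_le
    have := hdiv t ht i
    rw [← Finset.smul_sum, smul_comm, ← hvb, ← smul_sub, norm_smul,
      Real.norm_of_nonneg hlam_p.le] at this
    exact this
  obtain ⟨hdrift, hwstep, hvar⟩ := aux_cons (T := T) hτ ν hν hν0 lam_p q hlam_p hq0.le
    (by linarith) w (fun i t => x i (t + 1)) w0 hw0 hw wbar vb hwbar hvb κ hκ κbar hκbar hκ'
  have hκb0 : 0 ≤ κbar := by
    rw [hκbar]; exact mul_nonneg hν0 (Finset.sum_nonneg fun i _ => hκ i)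
  -- the two proximal steps
  have hxstep := fun i t (ht : t < T) => aux_prox (fun y => f i y + f i (Qt i y (c i t)))
    (fun y => lam * R i y (c i t))
    (fun y => gradient (f i) y + gradient (fun y => f i (Qt i y (c i t))) y) Lx lam_p
    (2 * lam_p + Lx) hlam_p.le hM1.le
    (fun y => aux_add_grad (hf i y).hasGradientAt
      (DifferentiableAt.hasGradientAt ((hf i _).comp y (hQd1 i (c i t) y))))
    ((hRd1 i (c i t)).const_mul lam)
    (by
      intro y z
      have h1 := aux_comp (f i) (fun z => Qt i z (c i t)) G L lQ1 LQ1 GQ1 hL0 (hf i)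
        (hQd1 i (c i t)) (hfG i) (hfL i) (hQl1 i _) (hQL1 i _) (hQG1 i _) y z
      have h2 := hfL i y z
      rw [add_sub_add_comm]
      refine (norm_add_le _ _).trans ?_
      rw [hLx]; linarith)
    (x i t) (x i (t + 1)) (w i t) (hx i t ht)
  have hcstep := fun i t (ht : t < T) => aux_prox (fun e => f i (Qt i (x i (t + 1)) e))
    (fun e => lam * R i (x i (t + 1)) e)
    (fun e => gradient (fun e => f i (Qt i (x i (t + 1)) e)) e) Lc 0
    Lc le_rfl hLc0.le
    (fun y =>
      (DifferentiableAt.hasGradientAt ((hf i _).comp y (hQd2 i (x i (t + 1)) y))))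
    ((hRd2 i (x i (t + 1))).const_mul lam)
    (by
      intro y z
      have h1 := aux_comp (f i) (fun e => Qt i (x i (t + 1)) e) G L lQ2 LQ2 GQ2 hL0 (hf i)
        (hQd2 i _) (hfG i) (hfL i) (hQl2 i _) (hQL2 i _) (hQG2 i _) y z
      rw [hLc]; exact h1)
    (c i t) (c i (t + 1)) 0 (by
      intro e
      have := hcup i t ht e
      simpa using this)
  -- potential
  obtain ⟨Φ, hΦ⟩ : ∃ Φ : ℕ → ℝ, ∀ t, Φ t = ν * ∑ i, Fi i (x i t) (c i t) (w i t) :=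
    ⟨_, fun _ => rfl⟩
  obtain ⟨P, hP⟩ : ∃ P : ℕ → ℝ, ∀ t, P t = ν * ∑ i, ‖x i (t + 1) - x i t‖ ^ 2 :=
    ⟨_, fun _ => rfl⟩
  obtain ⟨B, hB⟩ : ∃ B : ℕ → ℝ, ∀ t, B t = ν * ∑ i, ‖c i (t + 1) - c i t‖ ^ 2 :=
    ⟨_, fun _ => rfl⟩
  have hP0 : ∀ t, 0 ≤ P t := fun t => by
    rw [hP]; exact mul_nonneg hν0 (Finset.sum_nonneg fun i _ => sq_nonneg _)
  have hB0 : ∀ t, 0 ≤ B t := fun t => by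
    rw [hB]; exact mul_nonneg hν0 (Finset.sum_nonneg fun i _ => sq_nonneg _)
  obtain ⟨D, hD⟩ : ∃ D : ℕ → ℝ, ∀ t, D t = (3 * lam_p + Lx) / 2 * P t + Lc / 2 * B t
    + lam_p * (q - q ^ 2 / 2) * ‖vb t‖ ^ 2 := ⟨_, fun _ => rfl⟩
  have hdesc : ∀ t < T, D t ≤ Φ t - Φ (t + 1)
      + q * κbar / lam_p * (1 + (t % τ : ℕ) - ((t + 1) % τ : ℕ)) := by
    intro t ht
    have h1 : ∀ i, Fi i (x i (t + 1)) (c i (t + 1)) (w i (t + 1)) ≤ Fi i (x i t) (c i t) (w i t)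
        - (3 * lam_p + Lx) / 2 * ‖x i (t + 1) - x i t‖ ^ 2
        - Lc / 2 * ‖c i (t + 1) - c i t‖ ^ 2
        + (lam_p / 2 * ‖w i (t + 1) - x i (t + 1)‖ ^ 2
          - lam_p / 2 * ‖w i t - x i (t + 1)‖ ^ 2) := by
      intro i
      have a1 := (hxstep i t ht).1
      have a2 := (hcstep i t ht).1
      rw [hFi, hFi, norm_sub_rev (w i (t + 1)), norm_sub_rev (w i t)]
      simp only [zero_div, zero_mul, add_zero] at a2
      linarith
    have h2 := mul_le_mul_of_nonneg_left
      (Finset.sum_le_sum fun i (_ : i ∈ Finset.univ) => h1 i) hν0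
    simp only [Finset.sum_add_distrib, Finset.sum_sub_distrib, ← Finset.mul_sum] at h2
    have h3 := hwstep t ht
    rw [hD, hP, hB, hΦ, hΦ]
    linarith
  have htel : ∀ s ≤ T, ∑ t ∈ Finset.range s, D t ≤ Φ 0 - Φ s
      + q * κbar / lam_p * (s - (s % τ : ℕ)) := by
    intro s
    induction s with
    | zero => intro _; simp
    | succ s ih =>
      intro hs
      have h1 := ih (by omega)
      have h2 := hdesc s (by omega)
      rw [Finset.sum_range_succ]
      push_cast at *
      linarith
  have hsumD := htel T le_rfl
  have hΔ : Φ 0 - Φ T = ΔF := by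
    rw [hΔF, hΦ, hΦ, Finset.sum_sub_distrib]; ring
  rw [hΔ, Nat.mod_eq_zero_of_dvd hτT] at hsumD
  -- bound on the gradient norms
  have hgrad : ∀ t ∈ Finset.range T, ν * ∑ i,
        (‖gradient (fun y => Fi i y (c i t) (wbar t)) (x i (t + 1))‖ ^ 2
          + ‖gradient (fun e => Fi i (x i (t + 1)) e (wbar t)) (c i (t + 1))‖ ^ 2
          + ‖lam_p • (wbar t - x i (t + 1))‖ ^ 2)
      ≤ 288 * Lmax ^ 2 * lam_p * S * D t + (κbar + τ ^ 2 * κbar / (8 * T)) := by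
    intro t ht
    rw [Finset.mem_range] at ht
    have h1 : ∀ i, ‖gradient (fun y => Fi i y (c i t) (wbar t)) (x i (t + 1))‖ ^ 2
          + ‖gradient (fun e => Fi i (x i (t + 1)) e (wbar t)) (c i (t + 1))‖ ^ 2
          + ‖lam_p • (wbar t - x i (t + 1))‖ ^ 2
        ≤ 18 * Lmax ^ 2 * ‖x i (t + 1) - x i t‖ ^ 2 + 9 * Lmax ^ 2 * ‖c i (t + 1) - c i t‖ ^ 2
          + lam_p ^ 2 * ‖wbar t - x i (t + 1)‖ ^ 2 + 2 * q ^ 2 * τ ^ 2 * κ i := by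
      intro i
      have a1 := (hxstep i t ht).2 (wbar t) (fun y => Fi i y (c i t) (wbar t)) 0
        (by intro z; simp only [hFi]; ring)
      have a2 := (hcstep i t ht).2 0 (fun e => Fi i (x i (t + 1)) e (wbar t))
        (f i (x i (t + 1)) + lam_p / 2 * ‖x i (t + 1) - wbar t‖ ^ 2)
        (by intro z; simp only [hFi]; ring)
      have a3 := hdrift t ht.le i
      have a4 : ((t % τ : ℕ) : ℝ) ≤ τ := by exact_mod_cast (Nat.mod_lt t (by omega)).le
      have a5 : lam_p * ‖w i t - wbar t‖ ≤ q * √(κ i) * τ :=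
        a3.trans (mul_le_mul_of_nonneg_left a4 (by positivity))
      have a6 : (Lx + lam_p + 2 * (2 * lam_p + Lx)) * ‖x i (t + 1) - x i t‖
          ≤ 3 * Lmax * ‖x i (t + 1) - x i t‖ :=
        mul_le_mul_of_nonneg_right (by linarith) (norm_nonneg _)
      have a7 : (Lc + 0 + 2 * Lc) * ‖c i (t + 1) - c i t‖ ≤ 3 * Lmax * ‖c i (t + 1) - c i t‖ :=
        mul_le_mul_of_nonneg_right (by linarith) (norm_nonneg _)
      have b1 := pow_le_pow_left₀ (norm_nonneg _) (a1.trans (add_le_add a6 a5)) 2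
      have b2 := pow_le_pow_left₀ (norm_nonneg _)
        (a2.trans (add_le_add a7 (le_of_eq (zero_mul _)))) 2
      have b3 : ‖lam_p • (wbar t - x i (t + 1))‖ ^ 2
          = lam_p ^ 2 * ‖wbar t - x i (t + 1)‖ ^ 2 := by
        rw [norm_smul, mul_pow, Real.norm_of_nonneg hlam_p.le]
      have b4 : (q * √(κ i) * τ) ^ 2 = q ^ 2 * τ ^ 2 * κ i := by
        rw [mul_pow, mul_pow, Real.sq_sqrt (hκ i)]; ring
      have b5 := sq_nonneg (3 * Lmax * ‖x i (t + 1) - x i t‖ - q * √(κ i) * τ)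
      rw [b3]
      nlinarith
    have h2 := mul_le_mul_of_nonneg_left
      (Finset.sum_le_sum fun i (_ : i ∈ Finset.univ) => h1 i) hν0
    refine h2.trans ?_
    simp only [Finset.sum_add_distrib, ← Finset.mul_sum]
    have h3 := hvar t ht
    have h4 : 2 * q ^ 2 * τ ^ 2 * κbar = τ ^ 2 * κbar / (8 * T) := by
      have : q ^ 2 = 1 / (16 * T) := by
        rw [← hS2]; field_simp; linear_combination (16 * (q * S) + 4) * hqS
      rw [this]; field_simp; ring
    have hLsq : 1 ≤ Lmax ^ 2 := one_le_pow₀ hLm1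
    have c1 : 18 * Lmax ^ 2 * P t
        ≤ 288 * Lmax ^ 2 * lam_p * S * ((3 * lam_p + Lx) / 2 * P t) := by
      have : 18 ≤ 288 * lam_p * S * ((3 * lam_p + Lx) / 2) := by
        have : 0 ≤ lam_p * S * lam_p := by positivity
        nlinarith
      have := mul_le_mul_of_nonneg_right this (mul_nonneg (sq_nonneg Lmax) (hP0 t))
      linarith
    have c2 : 9 * Lmax ^ 2 * B t ≤ 288 * Lmax ^ 2 * lam_p * S * (Lc / 2 * B t) := by
      have : 9 ≤ 288 * lam_p * S * (Lc / 2) := by linarith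
      have := mul_le_mul_of_nonneg_right this (mul_nonneg (sq_nonneg Lmax) (hB0 t))
      linarith
    have c3 : lam_p ^ 2 * ‖vb t‖ ^ 2 ≤ 288 * Lmax ^ 2 * lam_p * S *
        (lam_p * (q - q ^ 2 / 2) * ‖vb t‖ ^ 2) := by
      have e : 288 * Lmax ^ 2 * lam_p * S * (lam_p * (q - q ^ 2 / 2) * ‖vb t‖ ^ 2)
          = 72 * (Lmax ^ 2 * (1 - q / 2)) * (lam_p ^ 2 * ‖vb t‖ ^ 2) := by
        linear_combination (288 * Lmax ^ 2 * lam_p ^ 2 * (1 - q / 2) * ‖vb t‖ ^ 2) * hqS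
      rw [e]
      have : 1 ≤ 72 * (Lmax ^ 2 * (1 - q / 2)) := by nlinarith
      exact le_mul_of_one_le_left (by positivity) this
    rw [hP] at c1
    rw [hB] at c2
    rw [hD, hP, hB]
    rw [hκbar] at h3 h4 ⊢
    linarith
  have hsum := Finset.sum_le_sum hgrad
  rw [Finset.sum_add_distrib, Finset.sum_const, Finset.card_range,
    nsmul_eq_mul] at hsum
  have hC := mul_le_mul_of_nonneg_left hsumD
    (show 0 ≤ 288 * Lmax ^ 2 * lam_p * S by positivity)
  rw [Finset.mul_sum] at hC
  have hLsq : 1 ≤ Lmax ^ 2 := one_le_pow₀ hLm1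
  have hfin := mul_le_mul_of_nonneg_left (hsum.trans (add_le_add_left hC _))
    (show 0 ≤ 1 / (T : ℝ) by positivity)
  refine hfin.trans ?_
  have e1 : 1 / (T : ℝ) * (288 * Lmax ^ 2 * lam_p * S * (ΔF + q * κbar / lam_p * (T - (0 : ℕ)))
      + T * (κbar + τ ^ 2 * κbar / (8 * T)))
      = 288 * Lmax ^ 2 * lam_p * ΔF / S + 72 * Lmax ^ 2 * κbar + κbar
        + τ ^ 2 * κbar / (8 * T) := by
    have : q = 1 / (4 * S) := by field_simp; linarith
    rw [this, ← hS2]; field_simp; push_cast; ring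
  rw [e1]
  have r1 : 0 ≤ (54 * Lmax ^ 2 * τ * κbar + 108 * Lmax ^ 2) / S := by positivity
  have r2 : 0 ≤ 378 * Lmax ^ 2 * τ ^ 2 * κbar / (T : ℝ) ^ ((3 : ℝ) / 2) := by positivity
  have r3 : τ ^ 2 * κbar / (8 * T)
      ≤ (189 * Lmax ^ 2 * τ ^ 2 * κbar + (3 / 4) * τ ^ 2 * κbar ^ 2) / (T : ℝ) := by
    rw [div_le_div_iff₀ (by positivity) hT0]
    have k0 : 0 ≤ τ ^ 2 * κbar * T := by positivity
    have k1 : τ ^ 2 * κbar * T ≤ Lmax ^ 2 * (τ ^ 2 * κbar * T) := le_mul_of_one_le_left k0 hLsq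
    have k2 : 0 ≤ Lmax ^ 2 * (τ ^ 2 * κbar * T) := by positivity
    have k3 : 0 ≤ τ ^ 2 * κbar ^ 2 * T := by positivity
    linarith
  have r4 : κbar ≤ Lmax ^ 2 * κbar := le_mul_of_one_le_left hκb0 hLsq
  have r5 : (54 * Lmax ^ 2 * τ * κbar + 108 * Lmax ^ 2 + 288 * Lmax ^ 2 * lam_p * ΔF) / S
      = (54 * Lmax ^ 2 * τ * κbar + 108 * Lmax ^ 2) / S
        + 288 * Lmax ^ 2 * lam_p * ΔF / S := by ring
  have r6 : 0 ≤ Lmax ^ 2 * κbar := by positivity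
  rw [r5]
  linarith
end

section
/- Let L_x := L + G·L_{Q1} + G_{Q1}·L·l_{Q1} and η₁ := 1/(2L_x). Fix c ∈ ℝ^m, x₀ ∈ ℝ^d, λ ∈ ℝ, and let g₀ := ∇_x f(Q̃_c(x))|_{x=x₀}. Suppose x⁺ is a global minimizer over x ∈ ℝ^d of the function x ↦ ⟨x − x₀, ∇f(x₀)⟩ + ⟨x − x₀, g₀⟩ + (1/(2η₁))·‖x − x₀‖² + λ·R(x, c). Then F_λ(x⁺, c) + (L_x/2)·‖x⁺ − x₀‖² ≤ F_λ(x₀, c). -/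
open RealInnerProductSpace

theorem descent_aux {E : Type*} [NormedAddCommGroup E] [NormedSpace ℝ E]
    (h : E → ℝ) (hd : Differentiable ℝ h) (K : ℝ) (x y : E)
    (hK : ∀ u v, ‖fderiv ℝ h u - fderiv ℝ h v‖ ≤ K * ‖u - v‖) :
    h y ≤ h x + fderiv ℝ h x (y - x) + K / 2 * ‖y - x‖ ^ 2 := by
  set v := y - x with hv
  have hder : ∀ t : ℝ, HasDerivAt
      (fun t : ℝ => h (x + t • v) - t * fderiv ℝ h x v - K / 2 * ‖v‖ ^ 2 * t ^ 2)
      (fderiv ℝ h (x + t • v) v - 1 * fderiv ℝ h x v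
        - K / 2 * ‖v‖ ^ 2 * (2 * t)) t := by
    intro t
    have h1 : HasDerivAt (fun t : ℝ => x + t • v) v t := by
      simpa using ((hasDerivAt_id t).smul_const v).const_add x
    have h2 := (hd (x + t • v)).hasFDerivAt.comp_hasDerivAt t h1
    have h3 := (hasDerivAt_id t).mul_const (fderiv ℝ h x v)
    have h4 : HasDerivAt (fun t : ℝ => t ^ 2) (2 * t) t := by
      simpa using hasDerivAt_pow 2 t
    exact (h2.sub h3).sub (h4.const_mul (K / 2 * ‖v‖ ^ 2))
  have hanti := antitoneOn_of_deriv_nonpos (convex_Icc (0 : ℝ) 1)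
    (fun t _ => (hder t).continuousAt.continuousWithinAt)
    (fun t _ => (hder t).differentiableAt.differentiableWithinAt)
    (fun t ht => by
      rw [(hder t).deriv]
      rw [interior_Icc] at ht
      have a1 := hK (x + t • v) x
      have a2 := (fderiv ℝ h (x + t • v) - fderiv ℝ h x).le_opNorm v
      have a3 := le_abs_self ((fderiv ℝ h (x + t • v) - fderiv ℝ h x) v)
      rw [Real.norm_eq_abs] at a2
      have a4 := mul_le_mul_of_nonneg_right a1 (norm_nonneg v)
      rw [add_sub_cancel_left, norm_smul, Real.norm_eq_abs, abs_of_pos ht.1] at a4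
      rw [sub_apply] at a2 a3
      nlinarith)
  have := hanti (Set.left_mem_Icc.2 zero_le_one) (Set.right_mem_Icc.2 zero_le_one) zero_le_one
  have hxy : x + v = y := by simp [hv]
  simp [hxy] at this
  linarith

theorem inner_gradient_aux {d : ℕ} (f : EuclideanSpace ℝ (Fin d) → ℝ)
    (x v : EuclideanSpace ℝ (Fin d)) : ⟪v, gradient f x⟫ = fderiv ℝ f x v := by
  rw [real_inner_comm, gradient, InnerProductSpace.toDual_symm_apply]

/-- Sufficient decrease of the proximal step in `x` (centralized setting):
if `x⁺` globally minimizes the linearized proximal objective with step size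
`η₁ = 1/(2 L_x)`, then `F_λ(x⁺, c) + (L_x/2)‖x⁺ − x₀‖² ≤ F_λ(x₀, c)`. -/
theorem stmt_10
    {d m : ℕ}
    (f : EuclideanSpace ℝ (Fin d) → ℝ)
    (Qt : EuclideanSpace ℝ (Fin d) → EuclideanSpace ℝ (Fin m) → EuclideanSpace ℝ (Fin d))
    (R : EuclideanSpace ℝ (Fin d) → EuclideanSpace ℝ (Fin m) → ℝ)
    (G L lQ1 LQ1 GQ1 : ℝ)
    (hf : Differentiable ℝ f)
    (hfG : ∀ x, ‖gradient f x‖ ≤ G)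
    (hfL : ∀ x y, ‖gradient f x - gradient f y‖ ≤ L * ‖x - y‖)
    (hQd1 : ∀ c, Differentiable ℝ (fun x => Qt x c))
    (hQl1 : ∀ c x y, ‖Qt x c - Qt y c‖ ≤ lQ1 * ‖x - y‖)
    (hQL1 : ∀ c x y,
      ‖fderiv ℝ (fun z => Qt z c) x - fderiv ℝ (fun z => Qt z c) y‖ ≤ LQ1 * ‖x - y‖)
    (hQG1 : ∀ c x, ‖fderiv ℝ (fun z => Qt z c) x‖ ≤ GQ1)
    (Lx η₁ : ℝ)
    (hLx : Lx = L + G * LQ1 + GQ1 * L * lQ1)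
    (hη₁ : η₁ = 1 / (2 * Lx))
    (c : EuclideanSpace ℝ (Fin m)) (x₀ xp : EuclideanSpace ℝ (Fin d)) (lam : ℝ)
    (hmin : ∀ z : EuclideanSpace ℝ (Fin d),
      ⟪xp - x₀, gradient f x₀⟫ + ⟪xp - x₀, gradient (fun y => f (Qt y c)) x₀⟫
          + (1 / (2 * η₁)) * ‖xp - x₀‖ ^ 2 + lam * R xp c
        ≤ ⟪z - x₀, gradient f x₀⟫ + ⟪z - x₀, gradient (fun y => f (Qt y c)) x₀⟫
          + (1 / (2 * η₁)) * ‖z - x₀‖ ^ 2 + lam * R z c) :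
    f xp + f (Qt xp c) + lam * R xp c + (Lx / 2) * ‖xp - x₀‖ ^ 2
      ≤ f x₀ + f (Qt x₀ c) + lam * R x₀ c := by
  have hη : 1 / (2 * η₁) = Lx := by
    rw [hη₁]
    by_cases h0 : Lx = 0
    · simp [h0]
    · field_simp
  rcases eq_or_ne xp x₀ with rfl | hne
  · simp
  have hpos : 0 < ‖xp - x₀‖ := norm_pos_iff.2 (sub_ne_zero.2 hne)
  have hL : 0 ≤ L := nonneg_of_mul_nonneg_left ((norm_nonneg _).trans (hfL xp x₀)) hpos
  have hG : 0 ≤ G := (norm_nonneg _).trans (hfG x₀)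
  have hfG' : ∀ x, ‖fderiv ℝ f x‖ ≤ G := by
    intro x
    have := hfG x
    rwa [gradient, LinearIsometryEquiv.norm_map] at this
  have hfL' : ∀ x y, ‖fderiv ℝ f x - fderiv ℝ f y‖ ≤ L * ‖x - y‖ := by
    intro x y
    have := hfL x y
    rwa [gradient, gradient, ← map_sub, LinearIsometryEquiv.norm_map] at this
  have hc : ∀ x, fderiv ℝ (fun y => f (Qt y c)) x
      = (fderiv ℝ f (Qt x c)).comp (fderiv ℝ (fun z => Qt z c) x) := fun x =>
    ((hf (Qt x c)).hasFDerivAt.comp x (hQd1 c x).hasFDerivAt).fderiv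
  have hcd : Differentiable ℝ (fun y => f (Qt y c)) := hf.comp (hQd1 c)
  have hcL : ∀ x y, ‖fderiv ℝ (fun y => f (Qt y c)) x - fderiv ℝ (fun y => f (Qt y c)) y‖
      ≤ (G * LQ1 + GQ1 * L * lQ1) * ‖x - y‖ := by
    intro x y
    rw [hc, hc]
    have e : (fderiv ℝ f (Qt x c)).comp (fderiv ℝ (fun z => Qt z c) x)
        - (fderiv ℝ f (Qt y c)).comp (fderiv ℝ (fun z => Qt z c) y)
        = (fderiv ℝ f (Qt x c)).comp
            (fderiv ℝ (fun z => Qt z c) x - fderiv ℝ (fun z => Qt z c) y)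
          + (fderiv ℝ f (Qt x c) - fderiv ℝ f (Qt y c)).comp (fderiv ℝ (fun z => Qt z c) y) := by
      ext v
      simp
    rw [e]
    have b1 : ‖(fderiv ℝ f (Qt x c)).comp
        (fderiv ℝ (fun z => Qt z c) x - fderiv ℝ (fun z => Qt z c) y)‖
        ≤ G * (LQ1 * ‖x - y‖) :=
      (ContinuousLinearMap.opNorm_comp_le _ _).trans
        (mul_le_mul (hfG' _) (hQL1 c x y) (norm_nonneg _) hG)
    have b0 : ‖fderiv ℝ f (Qt x c) - fderiv ℝ f (Qt y c)‖ ≤ L * (lQ1 * ‖x - y‖) :=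
      (hfL' _ _).trans (mul_le_mul_of_nonneg_left (hQl1 c x y) hL)
    have b2 : ‖(fderiv ℝ f (Qt x c) - fderiv ℝ f (Qt y c)).comp
        (fderiv ℝ (fun z => Qt z c) y)‖ ≤ (L * (lQ1 * ‖x - y‖)) * GQ1 :=
      (ContinuousLinearMap.opNorm_comp_le _ _).trans
        (mul_le_mul b0 (hQG1 c y) (norm_nonneg _) ((norm_nonneg _).trans b0))
    refine (norm_add_le _ _).trans ((add_le_add b1 b2).trans (le_of_eq ?_))
    ring
  have d1 := descent_aux f hf L x₀ xp hfL'
  have d2 := descent_aux _ hcd _ x₀ xp hcL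
  have hm := hmin x₀
  rw [hη] at hm
  simp only [inner_gradient_aux, sub_self, map_zero, norm_zero] at hm
  rw [hLx] at hm ⊢
  linarith
end
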